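/- arXiv:quant-ph/0310101 — 4 statements merged into one kernel-verified Lean document; each statement's English description precedes it below -/
import Mathlib

section
/- Let n ≥ 1, let K be the set of density matrices on ℂⁿ, regarded as a convex subset of the real vector space of n×n Hermitian complex matrices. For any two rank-one orthogonal projections E, F ∈ K, the affine ratio of E and F relative to K equals the real part of the trace of E*F, i.e. r_K(E,F) = (tr(E·F)).re. -/
open scoped ComplexOrder

/-- The affine ratio (transition probability) of `x` and `y` relative to a convex
subset `K` of a real vector space: the infimum of `f y` over affine maps
`f : V → ℝ` taking values in `[0,1]` on `K` with `f x = 1`. -/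
noncomputable def affineRatio {V : Type*} [AddCommGroup V] [Module ℝ V]
    (K : Set V) (x y : V) : ℝ :=
  sInf {r : ℝ | ∃ f : V →ᵃ[ℝ] ℝ, (∀ z ∈ K, f z ∈ Set.Icc (0 : ℝ) 1) ∧ f x = 1 ∧ f y = r}

/-- A rank-one orthogonal projection: a Hermitian matrix `P` with `P * P = P`
and `rank P = 1`. -/
def IsRankOneProj {n : ℕ} (P : Matrix (Fin n) (Fin n) ℂ) : Prop :=
  P.IsHermitian ∧ P * P = P ∧ P.rank = 1

open Matrix

section

variable {ι : Type*} [Fintype ι]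

/-- A real-linear functional that is nonnegative on density matrices is nonnegative on all positive
semidefinite matrices. -/
lemma nonneg_of_posSemidef_of_nonneg_on_density (g : Matrix ι ι ℂ →ₗ[ℝ] ℝ)
    (hg : ∀ D : Matrix ι ι ℂ, D.PosSemidef → D.trace = 1 → 0 ≤ g D)
    {X : Matrix ι ι ℂ} (hX : X.PosSemidef) : 0 ≤ g X := by
  obtain ⟨hre, him⟩ := Complex.nonneg_iff.mp hX.trace_nonneg
  have htr : X.trace = (X.trace.re : ℂ) := Complex.ext (by simp) (by simp [← him])
  rcases hre.eq_or_lt with h0 | hpos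
  · have : X = 0 := hX.trace_eq_zero_iff.mp (by rw [htr, ← h0, Complex.ofReal_zero])
    simp [this]
  · have hD := hg (X.trace.re⁻¹ • X) (hX.smul (inv_nonneg.mpr hre)) (by
      rw [trace_smul, htr, Complex.real_smul, Complex.ofReal_re, ← Complex.ofReal_mul,
        inv_mul_cancel₀ hpos.ne', Complex.ofReal_one])
    rw [map_smul, smul_eq_mul] at hD
    exact nonneg_of_mul_nonneg_right hD (inv_pos.mpr hpos)

lemma posSemidef_of_isHermitian_of_mul_self {P : Matrix ι ι ℂ} (hP : P.IsHermitian)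
    (hPP : P * P = P) : P.PosSemidef := by
  have h := posSemidef_conjTranspose_mul_self P
  rwa [hP.eq, hPP] at h

lemma posSemidef_mul_mul_of_isHermitian {A P : Matrix ι ι ℂ} (hP : P.IsHermitian)
    (hA : A.PosSemidef) : (P * A * P).PosSemidef := by
  have h := hA.conjTranspose_mul_mul_same P
  rwa [hP.eq] at h

lemma trace_mul_mul_of_mul_self {A P : Matrix ι ι ℂ} (hPP : P * P = P) :
    (P * A * P).trace = (P * A).trace := by
  rw [trace_mul_comm, ← Matrix.mul_assoc, hPP]

lemma re_trace_mul_nonneg {A P : Matrix ι ι ℂ} (hP : P.IsHermitian) (hPP : P * P = P)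
    (hA : A.PosSemidef) : 0 ≤ (P * A).trace.re := by
  rw [← trace_mul_mul_of_mul_self hPP]
  exact (Complex.nonneg_iff.mp (posSemidef_mul_mul_of_isHermitian hP hA).trace_nonneg).1

/-- The real part of the trace, as a real-linear functional. -/
noncomputable def reTrace : Matrix ι ι ℂ →ₗ[ℝ] ℝ :=
  Complex.reLm ∘ₗ traceLinearMap ι ℝ ℂ

lemma reTrace_apply (X : Matrix ι ι ℂ) : reTrace X = X.trace.re := rfl

variable [DecidableEq ι]

lemma one_sub_mul_self {P : Matrix ι ι ℂ} (hPP : P * P = P) : (1 - P) * (1 - P) = 1 - P :=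
  IsIdempotentElem.one_sub (a := P) hPP

/-- If a positive functional bounded by the trace vanishes at a projection `E`, then its value at a
projection `F` depends only on the compression of `F` to the complement of `E`, and so is at most
the trace of that compression. -/
lemma apply_le_re_trace_one_sub_mul (k : Matrix ι ι ℂ →ₗ[ℝ] ℝ)
    (hk0 : ∀ X : Matrix ι ι ℂ, X.PosSemidef → 0 ≤ k X)
    (hk1 : ∀ X : Matrix ι ι ℂ, X.PosSemidef → k X ≤ X.trace.re)
    {E F : Matrix ι ι ℂ} (hE : E.IsHermitian) (hEE : E * E = E)
    (hF : F.IsHermitian) (hFF : F * F = F) (hkE : k E = 0) :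
    k F ≤ ((1 - E) * F).trace.re := by
  have hF0 := posSemidef_of_isHermitian_of_mul_self hF hFF
  have hE' : (1 - E).IsHermitian := isHermitian_one.sub hE
  have hF1 : (1 - F).PosSemidef :=
    posSemidef_of_isHermitian_of_mul_self (isHermitian_one.sub hF) (one_sub_mul_self hFF)
  have hcorner : k (E * F * E) = 0 := by
    refine le_antisymm ?_ (hk0 _ (posSemidef_mul_mul_of_isHermitian hE hF0))
    have h := hk0 _ (posSemidef_mul_mul_of_isHermitian hE hF1)
    rw [Matrix.mul_sub, Matrix.sub_mul, Matrix.mul_one, hEE, map_sub, hkE] at h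
    linarith
  have hline : ∀ t : ℝ, 0 ≤ t * k (E * F * (1 - E) + (1 - E) * F * E)
      + k ((1 - E) * F * (1 - E)) := by
    intro t
    have hH : (t • E + (1 - E)).IsHermitian :=
      (hE.smul (IsSelfAdjoint.all t)).add hE'
    have h := hk0 _ (posSemidef_mul_mul_of_isHermitian hH hF0)
    have hexp : (t • E + (1 - E)) * F * (t • E + (1 - E)) = (t * t) • (E * F * E)
        + t • (E * F * (1 - E) + (1 - E) * F * E) + (1 - E) * F * (1 - E) := by
      generalize 1 - E = G
      simp only [Matrix.add_mul, Matrix.mul_add, Matrix.smul_mul, Matrix.mul_smul, smul_smul,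
        smul_add]
      abel
    rw [hexp, map_add, map_add, map_smul, map_smul, hcorner] at h
    simpa using h
  have hcross : k (E * F * (1 - E) + (1 - E) * F * E) = 0 := by
    by_contra hne
    have h := hline (-(k ((1 - E) * F * (1 - E)) + 1) / k (E * F * (1 - E) + (1 - E) * F * E))
    rw [div_mul_cancel₀ _ hne] at h
    linarith
  have hdecomp : F = E * F * E + (E * F * (1 - E) + (1 - E) * F * E)
      + (1 - E) * F * (1 - E) := by
    noncomm_ring
  calc k F = k ((1 - E) * F * (1 - E)) := by
        conv_lhs => rw [hdecomp, map_add, map_add, hcorner, hcross, zero_add, zero_add]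
    _ ≤ ((1 - E) * F * (1 - E)).trace.re :=
        hk1 _ (posSemidef_mul_mul_of_isHermitian hE' hF0)
    _ = ((1 - E) * F).trace.re := by
        rw [trace_mul_mul_of_mul_self (one_sub_mul_self hEE)]

end

theorem stmt0 (n : ℕ) (hn : 1 ≤ n)
    (K : Set (Matrix (Fin n) (Fin n) ℂ))
    (hK : K = {D : Matrix (Fin n) (Fin n) ℂ | D.PosSemidef ∧ D.trace = 1})
    (E F : Matrix (Fin n) (Fin n) ℂ)
    (hE : IsRankOneProj E) (hF : IsRankOneProj F)
    (hEK : E ∈ K) (hFK : F ∈ K) :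
    affineRatio K E F = ((E * F).trace).re := by
  subst hK
  obtain ⟨hEh, hEE, -⟩ := hE
  obtain ⟨hFh, hFF, -⟩ := hF
  refine IsLeast.csInf_eq ⟨⟨(reTrace ∘ₗ LinearMap.mulLeft ℝ E).toAffineMap, ?_, ?_, rfl⟩, ?_⟩
  · rintro D ⟨hD, hDtr⟩
    have h0 := re_trace_mul_nonneg hEh hEE hD
    have h1 := re_trace_mul_nonneg (isHermitian_one.sub hEh) (one_sub_mul_self hEE) hD
    rw [Matrix.sub_mul, Matrix.one_mul, trace_sub, hDtr, Complex.sub_re, Complex.one_re] at h1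
    exact ⟨h0, sub_nonneg.mp h1⟩
  · change (E * E).trace.re = 1
    rw [hEE, hEK.2, Complex.one_re]
  · rintro _ ⟨f, hf, hfE, rfl⟩
    have hfl : ∀ X, f X = f.linear X + f 0 := fun X => congrFun f.decomp X
    let h : Matrix (Fin n) (Fin n) ℂ →ₗ[ℝ] ℝ := f.linear + f 0 • reTrace
    have hh : ∀ D : Matrix (Fin n) (Fin n) ℂ, D.trace = 1 → h D = f D := fun D hD => by
      simp [h, reTrace_apply, hD, hfl D]
    have hk : ∀ X : Matrix (Fin n) (Fin n) ℂ,
        (reTrace - h : Matrix (Fin n) (Fin n) ℂ →ₗ[ℝ] ℝ) X = X.trace.re - h X :=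
      fun X => rfl
    have key := apply_le_re_trace_one_sub_mul (reTrace - h)
      (fun X hX => nonneg_of_posSemidef_of_nonneg_on_density _ (fun D hD hDtr => by
        rw [hk, hh D hDtr, hDtr, Complex.one_re]
        exact sub_nonneg.mpr (hf D ⟨hD, hDtr⟩).2) hX)
      (fun X hX => by
        have := nonneg_of_posSemidef_of_nonneg_on_density h (fun D hD hDtr => by
          rw [hh D hDtr]
          exact (hf D ⟨hD, hDtr⟩).1) hX
        rw [hk]
        linarith)
      hEh hEE hFh hFF (by rw [hk, hh E hEK.2, hEK.2, hfE, Complex.one_re, sub_self])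
    rw [hk, hh F hFK.2, Matrix.sub_mul, Matrix.one_mul, trace_sub, hFK.2, Complex.sub_re] at key
    linarith
end

section
/- Let K be the closed unit ball of the Euclidean space ℝⁿ and let x be a unit vector. Then for y ∈ K, the affine ratio satisfies r_K(x, y) = 0 if and only if y = −x; that is, −x is the unique point of K orthogonal to x in the sense of the affine ratio. -/
section

variable {E : Type*} [NormedAddCommGroup E] [InnerProductSpace ℝ E]

/-- An affine functional on a finite-dimensional inner product space is an inner product against
a fixed vector, up to a constant. -/
lemma AffineMap.exists_sub_eq_inner [FiniteDimensional ℝ E] (f : E →ᵃ[ℝ] ℝ) :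
    ∃ a : E, ∀ u v : E, f u - f v = inner ℝ a (u - v) := by
  refine ⟨(InnerProductSpace.toDual ℝ E).symm (LinearMap.toContinuousLinearMap f.linear),
    fun u v => ?_⟩
  rw [InnerProductSpace.toDual_symm_apply]
  exact (f.linearMap_vsub u v).symm

/-- A vector whose inner product with the unit vector `x` is at least its norm is a multiple
of `x`. -/
lemma eq_norm_smul_of_norm_le_inner {a x : E} (hx : ‖x‖ = 1) (h : ‖a‖ ≤ inner ℝ a x) :
    a = ‖a‖ • x := by
  have key := inner_eq_norm_mul_iff_real (x := a) (y := x)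
  rw [hx, mul_one, one_smul] at key
  exact key.1 (le_antisymm (by simpa [hx] using real_inner_le_norm a x) h)

/-- An affine functional with values in `[0, 1]` on the unit ball that attains `1` at the unit
vector `x` is bounded below by `z ↦ (1 + ⟪x, z⟫) / 2` on the ball. -/
lemma AffineMap.half_one_add_inner_le [FiniteDimensional ℝ E] {f : E →ᵃ[ℝ] ℝ} {x y : E}
    (hx : ‖x‖ = 1) (hy : ‖y‖ ≤ 1) (hf : ∀ z : E, ‖z‖ ≤ 1 → f z ∈ Set.Icc (0 : ℝ) 1)
    (hfx : f x = 1) : (1 + inner ℝ x y) / 2 ≤ f y := by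
  obtain ⟨a, ha⟩ := f.exists_sub_eq_inner
  have hle : ‖a‖ ≤ inner ℝ a x := by
    rcases eq_or_ne a 0 with rfl | h0
    · simp
    · have hn : ‖a‖ ≠ 0 := norm_ne_zero_iff.2 h0
      have h1 := (hf (‖a‖⁻¹ • a) (by simp [norm_smul, hn])).2
      have h2 := ha x (‖a‖⁻¹ • a)
      rw [inner_sub_right, real_inner_smul_right, real_inner_self_eq_norm_sq, pow_two,
        inv_mul_cancel_left₀ hn] at h2
      linarith
  have hax := eq_norm_smul_of_norm_le_inner hx hle
  have hsub : ∀ z, 1 - f z = ‖a‖ * (1 - inner ℝ x z) := fun z => by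
    have h := ha x z
    rw [hax, real_inner_smul_left, inner_sub_right, real_inner_self_eq_norm_sq, hx, hfx,
      one_pow] at h
    exact h
  have hneg := hsub (-x)
  rw [inner_neg_right, real_inner_self_eq_norm_sq, hx] at hneg
  have h0 := (hf (-x) (by simp [hx])).1
  have hxy : inner ℝ x y ≤ 1 := (real_inner_le_norm x y).trans (by simpa [hx] using hy)
  nlinarith [hsub y]

/-- The affine ratio relative to the unit ball of a unit vector `x` and a point `y` of the
ball. -/
theorem affineRatio_unitBall [FiniteDimensional ℝ E] {x y : E} (hx : ‖x‖ = 1) (hy : ‖y‖ ≤ 1) :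
    affineRatio {v : E | ‖v‖ ≤ 1} x y = (1 + inner ℝ x y) / 2 := by
  refine IsLeast.csInf_eq ⟨?_, ?_⟩
  · refine ⟨(1 / 2 : ℝ) • ((innerₛₗ ℝ x).toAffineMap + AffineMap.const ℝ E 1),
      fun z hz => ?_, ?_, ?_⟩
    · have h := abs_le.1 ((abs_real_inner_le_norm x z).trans (by simpa [hx] using hz))
      simp only [AffineMap.coe_smul, AffineMap.coe_add, Pi.smul_apply, Pi.add_apply,
        LinearMap.coe_toAffineMap, innerₛₗ_apply_apply, AffineMap.coe_const,
        Function.const_apply, smul_eq_mul, Set.mem_Icc]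
      constructor <;> linarith
    · simp [hx]; norm_num
    · simp; ring
  · rintro r ⟨f, hf, hfx, rfl⟩
    exact AffineMap.half_one_add_inner_le hx hy hf hfx

end

theorem stmt10 (n : ℕ) (x y : EuclideanSpace ℝ (Fin n))
    (hx : ‖x‖ = 1) (hy : ‖y‖ ≤ 1) :
    affineRatio {v : EuclideanSpace ℝ (Fin n) | ‖v‖ ≤ 1} x y = 0 ↔ y = -x := by
  rw [affineRatio_unitBall hx hy]
  constructor
  · intro h
    have hsq := norm_add_sq_real y x
    rw [real_inner_comm, hx] at hsq
    have hzero : ‖y + x‖ = 0 := by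
      nlinarith [norm_nonneg y, norm_nonneg (y + x)]
    exact eq_neg_of_add_eq_zero_left (norm_eq_zero.1 hzero)
  · rintro rfl
    simp [hx]
end

section
/- The set of extreme points of the separable state space K_sep of a pair of qubits is exactly the set of pure product states; i.e., a matrix is an extreme point of K_sep if and only if it is of the form E ⊗ₖ F with E, F rank-one orthogonal projections on ℂ². -/
open Kronecker

/-- The pure product states of a pair of qubits. -/
def pureProducts : Set (Matrix (Fin 2 × Fin 2) (Fin 2 × Fin 2) ℂ) :=
  {x | ∃ E F : Matrix (Fin 2) (Fin 2) ℂ, IsRankOneProj E ∧ IsRankOneProj F ∧ x = E ⊗ₖ F}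

/-- The separable state space of a pair of qubits. -/
def Ksep : Set (Matrix (Fin 2 × Fin 2) (Fin 2 × Fin 2) ℂ) :=
  convexHull ℝ pureProducts

open Matrix
open scoped ComplexOrder

/-- The squared Frobenius norm of a complex matrix. -/
def frobeniusSq {n : Type*} [Fintype n] (x : Matrix n n ℂ) : ℝ :=
  (xᴴ * x).trace.re

section Frobenius

variable {n : Type*} [Fintype n]

theorem frobeniusSq_nonneg (x : Matrix n n ℂ) : 0 ≤ frobeniusSq x :=
  (Complex.le_def.1 (posSemidef_conjTranspose_mul_self x).trace_nonneg).1

theorem eq_zero_of_frobeniusSq_eq_zero {x : Matrix n n ℂ} (h : frobeniusSq x = 0) : x = 0 :=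
  trace_conjTranspose_mul_self_eq_zero_iff.1 <|
    Complex.ext h (Complex.le_def.1 (posSemidef_conjTranspose_mul_self x).trace_nonneg).2.symm

theorem frobeniusSq_convexCombination (y z : Matrix n n ℂ) {a b : ℝ} (hab : a + b = 1) :
    frobeniusSq (a • y + b • z) =
      a * frobeniusSq y + b * frobeniusSq z - a * b * frobeniusSq (y - z) := by
  obtain rfl : b = 1 - a := by linarith
  simp only [frobeniusSq, conjTranspose_add, conjTranspose_sub, conjTranspose_smul, star_trivial,
    Matrix.add_mul, Matrix.mul_add, Matrix.sub_mul, Matrix.mul_sub, smul_mul_assoc,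
    mul_smul_comm, trace_add, trace_sub, trace_smul, Complex.add_re, Complex.sub_re,
    Complex.smul_re, smul_eq_mul]
  ring

theorem convex_frobeniusSq_le_one : Convex ℝ {x : Matrix n n ℂ | frobeniusSq x ≤ 1} := by
  intro y hy z hz a b ha hb hab
  simp only [Set.mem_ofPred_eq] at hy hz ⊢
  rw [frobeniusSq_convexCombination y z hab]
  have := mul_nonneg (mul_nonneg ha hb) (frobeniusSq_nonneg (y - z))
  nlinarith

/-- Points on the Frobenius unit sphere are extreme in every subset of the unit ball. -/
theorem mem_extremePoints_of_frobeniusSq_eq_one {K : Set (Matrix n n ℂ)}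
    (hK : ∀ x ∈ K, frobeniusSq x ≤ 1) {x : Matrix n n ℂ} (hx : x ∈ K)
    (hx1 : frobeniusSq x = 1) : x ∈ K.extremePoints ℝ := by
  refine mem_extremePoints_iff_left.2 ⟨hx, ?_⟩
  rintro y hy z hz ⟨a, b, ha, hb, hab, rfl⟩
  rw [frobeniusSq_convexCombination y z hab] at hx1
  have hy1 := hK y hy
  have hz1 := hK z hz
  have hle : a * b * frobeniusSq (y - z) ≤ 0 := by nlinarith
  have h0 : frobeniusSq (y - z) = 0 :=
    le_antisymm (nonpos_of_mul_nonpos_right hle (mul_pos ha hb)) (frobeniusSq_nonneg _)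
  obtain rfl : y = z := sub_eq_zero.1 (eq_zero_of_frobeniusSq_eq_zero h0)
  rw [← add_smul, hab, one_smul]

end Frobenius

theorem IsRankOneProj.trace_eq_one {n : ℕ} {P : Matrix (Fin n) (Fin n) ℂ}
    (hP : IsRankOneProj P) : P.trace = 1 := by
  have hidem : IsIdempotentElem (toLin' P) := by
    rw [IsIdempotentElem, Module.End.mul_eq_comp, ← toLin'_mul, hP.2.1]
  have h := (LinearMap.IsIdempotentElem.isProj_range _ hidem).trace
  rw [trace_toLin'_eq] at h
  rw [h, ← Nat.cast_one, ← hP.2.2]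
  rfl

theorem frobeniusSq_eq_one_of_mem_pureProducts
    {x : Matrix (Fin 2 × Fin 2) (Fin 2 × Fin 2) ℂ} (hx : x ∈ pureProducts) :
    frobeniusSq x = 1 := by
  obtain ⟨E, F, hE, hF, rfl⟩ := hx
  rw [frobeniusSq, conjTranspose_kronecker, hE.1.eq, hF.1.eq, ← mul_kronecker_mul, hE.2.1,
    hF.2.1, trace_kronecker, hE.trace_eq_one, hF.trace_eq_one, mul_one, Complex.one_re]

theorem stmt11 : Set.extremePoints ℝ Ksep = pureProducts := by
  refine Set.Subset.antisymm extremePoints_convexHull_subset fun x hx => ?_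
  refine mem_extremePoints_of_frobeniusSq_eq_one (fun y hy => ?_)
    (subset_convexHull ℝ pureProducts hx) (frobeniusSq_eq_one_of_mem_pureProducts hx)
  exact convexHull_min (fun z hz => (frobeniusSq_eq_one_of_mem_pureProducts hz).le)
    convex_frobeniusSq_le_one hy
end

section
/- Let K_sep denote the separable state space of a pair of qubits and fix a rank-one orthogonal projection x₀ on ℂ². There is no affine map η from the real vector space of 4×4 Hermitian complex matrices to itself such that η maps K_sep into K_sep and η(E ⊗ₖ x₀) = E ⊗ₖ E for every rank-one orthogonal projection E on ℂ². That is, the separable state space admits no cloning map. -/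
open Kronecker

open Matrix in
theorem isRankOneProj_vecMulVec_star {n : ℕ} (v : Fin n → ℂ) (hv : star v ⬝ᵥ v = 1) :
    IsRankOneProj (vecMulVec v (star v)) := by
  refine ⟨?_, ?_, le_antisymm (rank_vecMulVec_le v (star v)) ?_⟩
  · simp [IsHermitian, conjTranspose_vecMulVec]
  · simp [vecMulVec_mul_vecMulVec, hv]
  · rw [Nat.one_le_iff_ne_zero, ne_eq, rank, Submodule.finrank_eq_zero, LinearMap.range_eq_bot]
    intro h
    have hvv := LinearMap.congr_fun h v
    simp only [mulVecLin_apply, LinearMap.zero_apply, vecMulVec_mulVec, hv, MulOpposite.op_one, one_smul] at hvv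
    simp [hvv] at hv

/-- An affine cloning map sees only the average of an ensemble, so two decompositions `E + F`
and `G + H` of the same operator have the same cloned sum. -/
theorem kronecker_self_add_eq_of_clone {x₀ : Matrix (Fin 2) (Fin 2) ℂ}
    {η : Matrix (Fin 2 × Fin 2) (Fin 2 × Fin 2) ℂ
      →ᵃ[ℝ] Matrix (Fin 2 × Fin 2) (Fin 2 × Fin 2) ℂ}
    (hη : ∀ E : Matrix (Fin 2) (Fin 2) ℂ, IsRankOneProj E → η (E ⊗ₖ x₀) = E ⊗ₖ E)
    {E F G H : Matrix (Fin 2) (Fin 2) ℂ} (hE : IsRankOneProj E) (hF : IsRankOneProj F)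
    (hG : IsRankOneProj G) (hH : IsRankOneProj H) (h : E + F = G + H) :
    E ⊗ₖ E + F ⊗ₖ F = G ⊗ₖ G + H ⊗ₖ H := by
  have hmid : midpoint ℝ (E ⊗ₖ x₀) (F ⊗ₖ x₀) = midpoint ℝ (G ⊗ₖ x₀) (H ⊗ₖ x₀) := by
    rw [midpoint_eq_smul_add, midpoint_eq_smul_add, ← Matrix.add_kronecker,
      ← Matrix.add_kronecker, h]
  have himg := congrArg η hmid
  rw [η.map_midpoint, η.map_midpoint, hη E hE, hη F hF, hη G hG, hη H hH,
    midpoint_eq_smul_add, midpoint_eq_smul_add] at himg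
  exact (smul_right_injective _ (by norm_num : (⅟2 : ℝ) ≠ 0)) himg

/-- The separable state space admits no cloning map: no affine map sends
`E ⊗ₖ x₀` to `E ⊗ₖ E` for every rank-one projection (pure state) `E`, while
mapping separable states to separable states. -/
theorem stmt14 (x₀ : Matrix (Fin 2) (Fin 2) ℂ) (hx₀ : IsRankOneProj x₀) :
    ¬ ∃ η : Matrix (Fin 2 × Fin 2) (Fin 2 × Fin 2) ℂ
          →ᵃ[ℝ] Matrix (Fin 2 × Fin 2) (Fin 2 × Fin 2) ℂ,
        (∀ x ∈ Ksep, η x ∈ Ksep) ∧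
        (∀ E : Matrix (Fin 2) (Fin 2) ℂ, IsRankOneProj E → η (E ⊗ₖ x₀) = E ⊗ₖ E) := by
  rintro ⟨η, -, hη⟩
  have hsum : Matrix.vecMulVec ![1, 0] (star ![1, 0]) + Matrix.vecMulVec ![0, 1] (star ![0, 1]) =
      Matrix.vecMulVec ![3 / 5, 4 / 5] (star ![3 / 5, 4 / 5]) +
        Matrix.vecMulVec ![4 / 5, -3 / 5] (star ![(4 / 5 : ℂ), -3 / 5]) := by
    ext i j
    fin_cases i <;> fin_cases j <;>
      simp only [Matrix.add_apply, Matrix.vecMulVec_apply, Pi.star_apply] <;>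
      norm_num [map_ofNat]
  have hclone := kronecker_self_add_eq_of_clone hη
    (isRankOneProj_vecMulVec_star _ ?_) (isRankOneProj_vecMulVec_star _ ?_)
    (isRankOneProj_vecMulVec_star _ ?_) (isRankOneProj_vecMulVec_star _ ?_) hsum
  · have hentry := congrFun (congrFun hclone (0, 0)) (1, 1)
    simp only [Matrix.add_apply, Matrix.kroneckerMap_apply, Matrix.vecMulVec_apply,
      Pi.star_apply] at hentry
    norm_num [map_ofNat] at hentry
  all_goals norm_num [dotProduct, Fin.sum_univ_two, map_ofNat]
end
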